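/- Let n and k be integers with 40 ≤ k ≤ n/2, and set r = ⌊k/20⌋. Then i(n,k) ≥ (1 / (2^{13} r)) · E|𝓛(X_r)|. -/

import Mathlib

open scoped BigOperators

noncomputable section

/-- The set `𝓛(c) = { m₁ + 2m₂ + ⋯ + k·m_k : 0 ≤ m_j ≤ c_j }`. -/
def Lset (k : ℕ) (c : Fin k → ℕ) : Finset ℕ :=
  (Finset.Icc 0 c).image fun m => ∑ j : Fin k, ((j : ℕ) + 1) * m j

/-- Probability mass of a Poisson random variable with parameter `lam` at `n`. -/
def poissonPdf (lam : ℝ) (n : ℕ) : ℝ := Real.exp (-lam) * lam ^ n / (Nat.factorial n)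

/-- Joint probability mass of the independent vector `X_k = (X_1,…,X_k)`,
`X_i ∼ Pois(1/i)`, at `c`. -/
def pmfVec (k : ℕ) (c : Fin k → ℕ) : ℝ := ∏ i : Fin k, poissonPdf (1 / ((i : ℕ) + 1)) (c i)

/-- `E|𝓛(X_k)|`. -/
def EL (k : ℕ) : ℝ := ∑' c : Fin k → ℕ, ((Lset k c).card : ℝ) * pmfVec k c

/-- `π` has an invariant set of size `k`. -/
def hasInvariantSet (n k : ℕ) (π : Equiv.Perm (Fin n)) : Prop :=
  ∃ s : Finset (Fin n), s.card = k ∧ ∀ x ∈ s, π x ∈ s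

/-- `i(n,k)`: the proportion of permutations of `{1,…,n}` having an invariant set of size `k`. -/
def iProp (n k : ℕ) : ℝ :=
  (Nat.card {π : Equiv.Perm (Fin n) // hasInvariantSet n k π} : ℝ) /
    (Nat.card (Equiv.Perm (Fin n)) : ℝ)

/-- The common denominator `∏ j ^ m_j * m_j!` attached to a multiset with multiplicities `m_j`. -/
def cycleDenom (s : Multiset ℕ) : ℕ := s.prod * ∏ a ∈ s.toFinset, (s.count a).factorial

/-- The proportion of permutations whose multiset of cycle lengths (fixed points included)
is `s`. -/
def cycleWeight (s : Multiset ℕ) : ℝ := ((cycleDenom s : ℕ) : ℝ)⁻¹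

theorem cycleDenom_eq_of_subset (s : Multiset ℕ) {S : Finset ℕ} (h : s.toFinset ⊆ S) :
    cycleDenom s = s.prod * ∏ a ∈ S, (s.count a).factorial := by
  rw [cycleDenom, Finset.prod_subset h]
  intro x _ hx
  rw [Multiset.mem_toFinset] at hx
  rw [Multiset.count_eq_zero_of_notMem hx, Nat.factorial_zero]

theorem cycleDenom_pos {s : Multiset ℕ} (h : ∀ a ∈ s, 0 < a) : 0 < cycleDenom s := by
  refine Nat.mul_pos ?_ (Finset.prod_pos fun a _ => Nat.factorial_pos _)
  refine Nat.pos_of_ne_zero fun h0 => ?_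
  exact lt_irrefl 0 (h 0 (Multiset.prod_eq_zero_iff.mp h0))

theorem cycleWeight_nonneg (s : Multiset ℕ) : 0 ≤ cycleWeight s :=
  inv_nonneg.mpr (Nat.cast_nonneg _)

theorem cycleWeight_zero : cycleWeight 0 = 1 := by
  simp [cycleWeight, cycleDenom]

theorem cycleDenom_cons (a : ℕ) (s : Multiset ℕ) :
    cycleDenom (a ::ₘ s) = a * (s.count a + 1) * cycleDenom s := by
  rw [cycleDenom_eq_of_subset (a ::ₘ s) (Finset.Subset.refl _),
    cycleDenom_eq_of_subset s (S := (a ::ₘ s).toFinset)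
      (Multiset.toFinset_subset.mpr (Multiset.subset_cons s a)),
    Multiset.prod_cons]
  have ha : a ∈ (a ::ₘ s).toFinset := by simp
  rw [← Finset.mul_prod_erase _ _ ha, ← Finset.mul_prod_erase _ _ ha,
    Multiset.count_cons_self, Nat.factorial_succ]
  have : ∏ x ∈ (a ::ₘ s).toFinset.erase a, ((a ::ₘ s).count x).factorial =
      ∏ x ∈ (a ::ₘ s).toFinset.erase a, (s.count x).factorial :=
    Finset.prod_congr rfl fun x hx => by
      rw [Multiset.count_cons_of_ne (Finset.ne_of_mem_erase hx)]
  rw [this]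
  ring

theorem cycleWeight_cons (a : ℕ) (s : Multiset ℕ) :
    cycleWeight (a ::ₘ s) = cycleWeight s / (a * (s.count a + 1)) := by
  rw [cycleWeight, cycleWeight, cycleDenom_cons]
  push_cast
  rw [mul_inv, div_eq_inv_mul]

theorem cycleWeight_add {s t : Multiset ℕ} (h : Disjoint s t) :
    cycleWeight (s + t) = cycleWeight s * cycleWeight t := by
  rw [cycleWeight, cycleWeight, cycleWeight, ← mul_inv, ← Nat.cast_mul,
    cycleDenom_eq_of_subset s (S := (s + t).toFinset) (by simp),
    cycleDenom_eq_of_subset t (S := (s + t).toFinset) (by simp), cycleDenom,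
    mul_mul_mul_comm, ← Finset.prod_mul_distrib, Multiset.prod_add]
  congr 3
  refine Finset.prod_congr rfl fun x _ => ?_
  rw [Multiset.count_add]
  by_cases hx : x ∈ s
  · rw [Multiset.count_eq_zero_of_notMem (Multiset.disjoint_left.mp h hx)]
    simp
  · rw [Multiset.count_eq_zero_of_notMem hx]
    simp

/-- The multiset containing `j + 1` exactly `c j` times. -/
def multOf {r : ℕ} (c : Fin r → ℕ) : Multiset ℕ :=
  ∑ j : Fin r, c j • ({(j : ℕ) + 1} : Multiset ℕ)

theorem count_multOf {r : ℕ} (c : Fin r → ℕ) (j : Fin r) :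
    (multOf c).count ((j : ℕ) + 1) = c j := by
  rw [multOf, Multiset.count_sum']
  simp only [Multiset.count_nsmul, Multiset.count_singleton, add_left_inj, mul_ite, mul_one,
    mul_zero, Fin.val_inj]
  rw [Finset.sum_ite_eq]
  simp

theorem mem_multOf {r : ℕ} {c : Fin r → ℕ} {x : ℕ} (h : x ∈ multOf c) :
    ∃ j : Fin r, x = (j : ℕ) + 1 := by
  rw [multOf, Multiset.mem_sum] at h
  obtain ⟨j, -, hj⟩ := h
  exact ⟨j, Multiset.mem_singleton.mp (Multiset.mem_of_mem_nsmul hj)⟩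

theorem sum_multOf {r : ℕ} (c : Fin r → ℕ) :
    (multOf c).sum = ∑ j : Fin r, ((j : ℕ) + 1) * c j := by
  rw [multOf, Multiset.sum_sum]
  refine Finset.sum_congr rfl fun j _ => ?_
  rw [Multiset.sum_nsmul, Multiset.sum_singleton, smul_eq_mul, mul_comm]

theorem multOf_mono {r : ℕ} {c d : Fin r → ℕ} (h : c ≤ d) : multOf c ≤ multOf d :=
  Finset.sum_le_sum fun j _ => nsmul_le_nsmul_left (Multiset.zero_le _) (h j)

theorem cycleWeight_multOf {r : ℕ} (c : Fin r → ℕ) :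
    cycleWeight (multOf c) =
      ∏ j : Fin r, (1 / ((j : ℕ) + 1 : ℝ)) ^ c j / ((c j).factorial : ℝ) := by
  have hsub : (multOf c).toFinset ⊆ Finset.univ.image fun j : Fin r => (j : ℕ) + 1 := by
    intro x hx
    obtain ⟨j, rfl⟩ := mem_multOf (Multiset.mem_toFinset.mp hx)
    exact Finset.mem_image_of_mem _ (Finset.mem_univ j)
  rw [cycleWeight, cycleDenom_eq_of_subset _ hsub, Finset.prod_image]
  · simp only [count_multOf]
    rw [multOf, Multiset.prod_sum]
    simp only [Multiset.prod_nsmul, Multiset.prod_singleton]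
    rw [← Finset.prod_mul_distrib]
    push_cast
    rw [← Finset.prod_inv_distrib]
    refine Finset.prod_congr rfl fun j _ => ?_
    rw [mul_inv, one_div, inv_pow, div_eq_mul_inv]
  · intro i _ j _ hij
    exact Fin.ext (Nat.succ_injective hij)

/-- The multisets of natural numbers that are at least `t`, with sum `m`. -/
def partsGe (t m : ℕ) : Finset (Multiset ℕ) :=
  ((Finset.univ : Finset m.Partition).image Nat.Partition.parts).filter fun q => ∀ a ∈ q, t ≤ a

theorem mem_partsGe {t m : ℕ} (ht : 0 < t) {q : Multiset ℕ} :
    q ∈ partsGe t m ↔ q.sum = m ∧ ∀ a ∈ q, t ≤ a := by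
  simp only [partsGe, Finset.mem_filter, Finset.mem_image, Finset.mem_univ, true_and]
  constructor
  · rintro ⟨⟨p, rfl⟩, h⟩
    exact ⟨p.parts_sum, h⟩
  · rintro ⟨h1, h2⟩
    exact ⟨⟨⟨q, fun h => ht.trans_le (h2 _ h), h1⟩, rfl⟩, h2⟩

theorem sum_Icc_mul_count {t m : ℕ} (ht : 0 < t) {q : Multiset ℕ} (hq : q ∈ partsGe t m) :
    ∑ a ∈ Finset.Icc t m, a * q.count a = m := by
  obtain ⟨h1, h2⟩ := (mem_partsGe ht).mp hq
  subst h1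
  conv_rhs => rw [Finset.sum_multiset_count q]
  simp only [smul_eq_mul]
  symm
  rw [Finset.sum_subset (s₂ := Finset.Icc t q.sum)]
  · exact Finset.sum_congr rfl fun _ _ => mul_comm _ _
  · intro x hx
    rw [Multiset.mem_toFinset] at hx
    exact Finset.mem_Icc.mpr ⟨h2 x hx, Multiset.le_sum_of_mem hx⟩
  · intro x _ hx
    rw [Multiset.mem_toFinset] at hx
    simp [Multiset.count_eq_zero_of_notMem hx]

theorem sum_partsGe_sub_le {t m a : ℕ} (ht : 0 < t) (hta : t ≤ a) (ham : a ≤ m) :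
    ∑ q ∈ partsGe t (m - a), cycleWeight q ≤
      ∑ q ∈ partsGe t m, cycleWeight q * (a * q.count a : ℕ) := by
  have hinj : Function.Injective (fun q : Multiset ℕ => a ::ₘ q) :=
    fun _ _ h => (Multiset.cons_inj_right a).mp h
  have hsub : (partsGe t (m - a)).image (fun q => a ::ₘ q) ⊆ partsGe t m := by
    intro p hp
    obtain ⟨q, hq, rfl⟩ := Finset.mem_image.mp hp
    obtain ⟨h1, h2⟩ := (mem_partsGe ht).mp hq
    refine (mem_partsGe ht).mpr ⟨?_, ?_⟩
    · rw [Multiset.sum_cons]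
      omega
    · intro b hb
      rcases Multiset.mem_cons.mp hb with rfl | hb
      · exact hta
      · exact h2 b hb
  refine le_trans (le_of_eq ?_) (Finset.sum_le_sum_of_subset_of_nonneg hsub
    fun p _ _ => mul_nonneg (cycleWeight_nonneg p) (Nat.cast_nonneg _))
  rw [Finset.sum_image fun _ _ _ _ h => hinj h]
  refine Finset.sum_congr rfl fun q _ => ?_
  rw [cycleWeight_cons, Multiset.count_cons_self]
  have : (0 : ℝ) < a := by exact_mod_cast ht.trans_le hta
  push_cast
  field_simp

theorem le_sum_partsGe {t : ℕ} (ht : 0 < t) (m : ℕ) (htm : t ≤ m) :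
    1 / (2 * t - 1 : ℝ) ≤ ∑ q ∈ partsGe t m, cycleWeight q := by
  have ht1 : (1 : ℝ) ≤ t := by exact_mod_cast ht
  have hd : (0 : ℝ) < 2 * t - 1 := by linarith
  induction m using Nat.strong_induction_on with
  | _ m ih =>
    have hm : (0 : ℝ) < m := by exact_mod_cast ht.trans_le htm
    have hrec : ∑ a ∈ Finset.Icc t m, ∑ q ∈ partsGe t (m - a), cycleWeight q ≤
        m * ∑ q ∈ partsGe t m, cycleWeight q := by
      calc _ ≤ ∑ a ∈ Finset.Icc t m,
            ∑ q ∈ partsGe t m, cycleWeight q * (a * q.count a : ℕ) :=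
          Finset.sum_le_sum fun a ha =>
            sum_partsGe_sub_le ht (Finset.mem_Icc.mp ha).1 (Finset.mem_Icc.mp ha).2
        _ = _ := by
          rw [Finset.sum_comm, Finset.mul_sum]
          refine Finset.sum_congr rfl fun q hq => ?_
          rw [← Finset.mul_sum, ← Nat.cast_sum, sum_Icc_mul_count ht hq, mul_comm]
    have hnn : ∀ a, 0 ≤ ∑ q ∈ partsGe t (m - a), cycleWeight q :=
      fun a => Finset.sum_nonneg fun q _ => cycleWeight_nonneg q
    have hzero : 1 ≤ ∑ q ∈ partsGe t (m - m), cycleWeight q := by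
      rw [← cycleWeight_zero]
      refine Finset.single_le_sum (f := cycleWeight) (fun q _ => cycleWeight_nonneg q) ?_
      exact (mem_partsGe ht).mpr (by simp)
    have hlow : (m : ℝ) / (2 * t - 1) ≤
        ∑ a ∈ Finset.Icc t m, ∑ q ∈ partsGe t (m - a), cycleWeight q := by
      rcases lt_or_ge m (2 * t - 1) with hlt | hge
      · refine le_trans ?_ (hzero.trans (Finset.single_le_sum
          (f := fun a => ∑ q ∈ partsGe t (m - a), cycleWeight q)
          (fun a _ => hnn a) (Finset.mem_Icc.mpr ⟨htm, le_rfl⟩)))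
        rw [div_le_one hd]
        have : m + 1 ≤ 2 * t := by omega
        have : (m : ℝ) + 1 ≤ 2 * t := by exact_mod_cast this
        linarith
      · have hnot : m ∉ Finset.Icc t (m - t) := by
          rw [Finset.mem_Icc]
          omega
        have hsub : insert m (Finset.Icc t (m - t)) ⊆ Finset.Icc t m := by
          intro x hx
          rw [Finset.mem_insert, Finset.mem_Icc] at hx
          rw [Finset.mem_Icc]
          omega
        refine le_trans ?_ (Finset.sum_le_sum_of_subset_of_nonneg hsub fun a _ _ => hnn a)
        rw [Finset.sum_insert hnot]
        have hcard : ((Finset.Icc t (m - t)).card : ℝ) = m - (2 * t - 1) := by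
          rw [Nat.card_Icc]
          have : m - t + 1 - t + 2 * t = m + 1 := by omega
          have : ((m - t + 1 - t : ℕ) : ℝ) + 2 * t = m + 1 := by exact_mod_cast this
          linarith
        have := Finset.card_nsmul_le_sum (Finset.Icc t (m - t))
          (fun a => ∑ q ∈ partsGe t (m - a), cycleWeight q) (1 / (2 * t - 1 : ℝ))
          (fun a ha => by
            rw [Finset.mem_Icc] at ha
            exact ih (m - a) (by omega) (by omega))
        rw [nsmul_eq_mul, hcard] at this
        have hsplit : (m : ℝ) / (2 * t - 1) = 1 + (m - (2 * t - 1)) * (1 / (2 * t - 1)) := by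
          field_simp
          ring
        linarith
    have := hlow.trans hrec
    rw [div_eq_mul_one_div] at this
    exact le_of_mul_le_mul_left this hm

theorem exists_le_map_eq {α β : Type*} (f : α → β) (s : Multiset α) {t : Multiset β}
    (h : t ≤ s.map f) : ∃ u ≤ s, u.map f = t := by
  induction s using Quotient.inductionOn with
  | _ l =>
    induction t using Quotient.inductionOn with
    | _ l' =>
      simp only [Multiset.quot_mk_to_coe, Multiset.map_coe, Multiset.coe_le] at h
      obtain ⟨l₁, hp, hs⟩ := h
      obtain ⟨l₂, hl₂, rfl⟩ := List.sublist_map_iff.mp hs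
      exact ⟨l₂, Multiset.coe_le.mpr hl₂.subperm, Multiset.coe_eq_coe.mpr hp⟩

theorem card_perm_parts_eq {n : ℕ} {p : Multiset ℕ} (hpos : ∀ a ∈ p, 0 < a) (hsum : p.sum = n) :
    ((Finset.univ.filter fun π : Equiv.Perm (Fin n) => π.partition.parts = p).card : ℝ) =
      n.factorial * cycleWeight p := by
  have hp : p = p.filter (fun a => 2 ≤ a) + Multiset.replicate (p.count 1) 1 := by
    ext a
    rw [Multiset.count_add, Multiset.count_replicate, Multiset.count_filter]
    rcases Nat.lt_trichotomy a 1 with h | rfl | h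
    · have : a ∉ p := fun ha => by have := hpos a ha; omega
      rw [Multiset.count_eq_zero_of_notMem this]
      split_ifs <;> omega
    · simp
    · rw [if_pos (by omega), if_neg (by omega), add_zero]
  set q := p.filter (fun a => 2 ≤ a) with hq
  have hqs : q.sum + p.count 1 = n := by
    rw [← hsum]
    conv_rhs => rw [hp]
    simp
  have hset : (Finset.univ.filter fun π : Equiv.Perm (Fin n) => π.partition.parts = p) =
      Finset.univ.filter fun π : Equiv.Perm (Fin n) => π.cycleType = q := by
    ext π
    simp only [Finset.mem_filter, Finset.mem_univ, true_and]
    constructor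
    · rintro rfl
      exact Equiv.Perm.filter_parts_partition_eq_cycleType.symm
    · intro h
      rw [Equiv.Perm.parts_partition, ← Equiv.Perm.sum_cycleType, h, Fintype.card_fin, hp]
      congr 2
      omega
  have hq2 : ∀ a ∈ q, 2 ≤ a := fun a ha => (Multiset.mem_filter.mp ha).2
  have hden : cycleDenom p =
      (n - q.sum).factorial * q.prod * ∏ a ∈ q.toFinset, (q.count a).factorial := by
    have hdisj : Disjoint q (Multiset.replicate (p.count 1) 1) := by
      rw [Multiset.disjoint_left]
      intro a ha ha'
      have := hq2 a ha
      have := Multiset.eq_of_mem_replicate ha'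
      omega
    have h1 : 1 ∉ q.toFinset := fun h => by
      have := hq2 1 (Multiset.mem_toFinset.mp h)
      omega
    have h1q : q.count 1 = 0 :=
      Multiset.count_eq_zero_of_notMem fun h => h1 (Multiset.mem_toFinset.mpr h)
    have hsub : p.toFinset ⊆ insert 1 q.toFinset := by
      intro a ha
      rw [hp, Multiset.mem_toFinset, Multiset.mem_add] at ha
      rcases ha with ha | ha
      · exact Finset.mem_insert_of_mem (Multiset.mem_toFinset.mpr ha)
      · rw [Multiset.eq_of_mem_replicate ha]
        exact Finset.mem_insert_self _ _
    rw [cycleDenom_eq_of_subset p hsub, Finset.prod_insert h1]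
    have hprod : p.prod = q.prod := by
      conv_lhs => rw [hp]
      simp
    have hcount : ∏ a ∈ q.toFinset, (p.count a).factorial =
        ∏ a ∈ q.toFinset, (q.count a).factorial := by
      refine Finset.prod_congr rfl fun a ha => ?_
      rw [hq, Multiset.count_filter, if_pos (hq2 a (Multiset.mem_toFinset.mp ha))]
    have hn1 : n - q.sum = p.count 1 := by omega
    rw [hprod, hcount, hn1]
    ring
  have hmul := Equiv.Perm.card_of_cycleType_mul_eq (Fin n) q
  rw [Fintype.card_fin, if_pos ⟨by omega, hq2⟩, ← hden] at hmul
  have hpos' : (0 : ℝ) < cycleDenom p := by exact_mod_cast cycleDenom_pos hpos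
  rw [hset, cycleWeight, ← div_eq_mul_inv, eq_div_iff hpos'.ne']
  exact_mod_cast hmul

theorem hasInvariantSet_of_le_parts {n k : ℕ} {π : Equiv.Perm (Fin n)} {t : Multiset ℕ}
    (ht : t ≤ π.partition.parts) (hk : t.sum = k) : hasInvariantSet n k π := by
  rw [Equiv.Perm.parts_partition] at ht
  obtain ⟨t₁, t₂, h₁, h₂, rfl⟩ : ∃ t₁ t₂, t₁ ≤ π.cycleType ∧
      t₂ ≤ Multiset.replicate (Fintype.card (Fin n) - π.support.card) 1 ∧ t = t₁ + t₂ := by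
    refine ⟨t ∩ π.cycleType, t - π.cycleType, Multiset.inter_le_right,
      tsub_le_iff_left.mpr ht, ?_⟩
    ext a
    rw [Multiset.count_add, Multiset.count_inter, Multiset.count_sub]
    omega
  obtain ⟨j, hj, rfl⟩ := Multiset.le_replicate_iff.mp h₂
  rw [Equiv.Perm.cycleType_def] at h₁
  obtain ⟨u, hu, rfl⟩ := exists_le_map_eq _ _ h₁
  have hnd : u.Nodup := Multiset.nodup_of_le hu π.cycleFactorsFinset.nodup
  set U : Finset (Equiv.Perm (Fin n)) := ⟨u, hnd⟩ with hU
  have hUsub : ∀ σ ∈ U, σ ∈ π.cycleFactorsFinset := fun σ hσ => Multiset.mem_of_le hu hσ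
  have hfix : j ≤ (π.supportᶜ).card := by
    rw [Finset.card_compl]
    simpa using hj
  obtain ⟨F, hF, hFc⟩ := Finset.exists_subset_card_eq hfix
  refine ⟨U.biUnion Equiv.Perm.support ∪ F, ?_, ?_⟩
  · rw [Finset.card_union_of_disjoint, Finset.card_biUnion, hFc, ← hk]
    · simp [hU, Finset.sum]
    · intro σ hσ τ hτ hne
      exact (Equiv.Perm.cycleFactorsFinset_pairwise_disjoint π (hUsub σ hσ) (hUsub τ hτ)
        hne).disjoint_support
    · rw [Finset.disjoint_left]
      intro x hx hxF
      obtain ⟨σ, hσ, hxσ⟩ := Finset.mem_biUnion.mp hx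
      exact Finset.mem_compl.mp (hF hxF)
        (Equiv.Perm.mem_cycleFactorsFinset_support_le (hUsub σ hσ) hxσ)
  · intro x hx
    rcases Finset.mem_union.mp hx with hx | hx
    · obtain ⟨σ, hσ, hxσ⟩ := Finset.mem_biUnion.mp hx
      refine Finset.mem_union_left _ (Finset.mem_biUnion.mpr ⟨σ, hσ, ?_⟩)
      rw [← (Equiv.Perm.mem_cycleFactorsFinset_iff.mp (hUsub σ hσ)).2 x hxσ]
      exact Equiv.Perm.apply_mem_support.mpr hxσ
    · have := Finset.mem_compl.mp (hF hx)
      rw [Equiv.Perm.notMem_support.mp this]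
      exact Finset.mem_union_right _ hx

theorem sum_cycleWeight_le_iProp {n k : ℕ} (T : Finset (Multiset ℕ))
    (hT : ∀ p ∈ T, (∀ a ∈ p, 0 < a) ∧ p.sum = n ∧ ∃ t ≤ p, t.sum = k) :
    ∑ p ∈ T, cycleWeight p ≤ iProp n k := by
  classical
  have hn : (0 : ℝ) < n.factorial := by exact_mod_cast n.factorial_pos
  have hperm : Nat.card (Equiv.Perm (Fin n)) = n.factorial := by
    rw [Nat.card_eq_fintype_card, Fintype.card_perm, Fintype.card_fin]
  rw [iProp, hperm, le_div_iff₀ hn, Finset.sum_mul]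
  calc ∑ p ∈ T, cycleWeight p * n.factorial
      = ∑ p ∈ T,
        ((Finset.univ.filter fun π : Equiv.Perm (Fin n) => π.partition.parts = p).card : ℝ) :=
        Finset.sum_congr rfl fun p hp => by
          rw [card_perm_parts_eq (hT p hp).1 (hT p hp).2.1, mul_comm]
    _ = ((Finset.univ.filter fun π : Equiv.Perm (Fin n) => π.partition.parts ∈ T).card : ℝ) := by
        rw [← Nat.cast_sum, Finset.card_eq_sum_card_fiberwise (t := T)
          (f := fun π : Equiv.Perm (Fin n) => π.partition.parts)]
        · congr 1
          refine Finset.sum_congr rfl fun p hp => ?_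
          congr 1
          ext π
          simp only [Finset.mem_filter, Finset.mem_univ, true_and]
          exact ⟨fun h => ⟨h ▸ hp, h⟩, fun h => h.2⟩
        · intro π hπ
          exact (Finset.mem_filter.mp hπ).2
    _ ≤ _ := by
        rw [Nat.card_eq_fintype_card, Fintype.card_subtype]
        refine Nat.cast_le.mpr (Finset.card_le_card fun π hπ => ?_)
        obtain ⟨-, -, t, ht, htk⟩ := hT _ (Finset.mem_filter.mp hπ).2
        exact Finset.mem_filter.mpr ⟨Finset.mem_univ _, hasInvariantSet_of_le_parts ht htk⟩

theorem multOf_add_single {r : ℕ} (c : Fin r → ℕ) (j : Fin r) :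
    multOf (c + Pi.single j 1) = ((j : ℕ) + 1) ::ₘ multOf c := by
  simp only [multOf, Pi.add_apply, add_nsmul, Finset.sum_add_distrib]
  rw [← Multiset.singleton_add, add_comm]
  congr 1
  rw [Finset.sum_eq_single j]
  · simp
  · intro i _ hi
    simp [hi]
  · simp

theorem mem_Lset {r : ℕ} {c : Fin r → ℕ} {l : ℕ} :
    l ∈ Lset r c ↔ ∃ m ≤ c, (multOf m).sum = l := by
  simp [Lset, sum_multOf, Pi.le_def]

theorem card_Lset_add_single_le {r : ℕ} (c : Fin r → ℕ) (j : Fin r) :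
    (Lset r (c + Pi.single j 1)).card ≤ 2 * (Lset r c).card := by
  have hsub : Lset r (c + Pi.single j 1) ⊆
      Lset r c ∪ (Lset r c).image fun l => ((j : ℕ) + 1) + l := by
    intro l hl
    obtain ⟨m, hm, rfl⟩ := mem_Lset.mp hl
    rw [Finset.mem_union, Finset.mem_image]
    by_cases h : m j ≤ c j
    · refine Or.inl (mem_Lset.mpr ⟨m, fun i => ?_, rfl⟩)
      by_cases hi : i = j
      · exact hi ▸ h
      · simpa [hi] using hm i
    · have hm' : m = (m - Pi.single j 1) + Pi.single j 1 := by
        refine (tsub_add_cancel_of_le fun i => ?_).symm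
        by_cases hi : i = j
        · subst hi
          simp
          omega
        · simp [hi]
      refine Or.inr ⟨(multOf (m - Pi.single j 1)).sum,
        mem_Lset.mpr ⟨_, tsub_le_iff_right.mpr hm, rfl⟩, ?_⟩
      conv_rhs => rw [hm', multOf_add_single, Multiset.sum_cons]
  calc _ ≤ _ := Finset.card_le_card hsub
    _ ≤ (Lset r c).card + ((Lset r c).image fun l => ((j : ℕ) + 1) + l).card :=
      Finset.card_union_le _ _
    _ ≤ (Lset r c).card + (Lset r c).card :=
      Nat.add_le_add_left Finset.card_image_le _
    _ = _ := (two_mul _).symm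

theorem pmfVec_eq {r : ℕ} (c : Fin r → ℕ) :
    pmfVec r c = (∏ j : Fin r, Real.exp (-(1 / ((j : ℕ) + 1 : ℝ)))) * cycleWeight (multOf c) := by
  rw [pmfVec, cycleWeight_multOf, ← Finset.prod_mul_distrib]
  refine Finset.prod_congr rfl fun j _ => ?_
  rw [poissonPdf, mul_div_assoc]

theorem prod_exp_le (r : ℕ) :
    ∏ j : Fin r, Real.exp (-(1 / ((j : ℕ) + 1 : ℝ))) ≤ 1 / (r + 1) := by
  rw [Fin.prod_univ_eq_prod_range (fun j : ℕ => Real.exp (-(1 / ((j : ℕ) + 1 : ℝ))))]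
  induction r with
  | zero => simp
  | succ r ih =>
    rw [Finset.prod_range_succ]
    have h : Real.exp (-(1 / (r + 1 : ℝ))) ≤ (r + 1) / (r + 2) := by
      rw [Real.exp_neg]
      have h1 := Real.add_one_le_exp (1 / (r + 1 : ℝ))
      have h2 : (1 / (r + 1 : ℝ)) + 1 = (r + 2) / (r + 1) := by
        field_simp
        ring
      rw [h2] at h1
      have := inv_anti₀ (by positivity) h1
      rwa [inv_div] at this
    calc _ ≤ 1 / (r + 1 : ℝ) * ((r + 1) / (r + 2)) :=
          mul_le_mul ih h (Real.exp_pos _).le (by positivity)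
      _ = _ := by
        push_cast
        field_simp
        ring

theorem pmfVec_nonneg {r : ℕ} (c : Fin r → ℕ) : 0 ≤ pmfVec r c := by
  rw [pmfVec_eq]
  exact mul_nonneg (Finset.prod_nonneg fun _ _ => (Real.exp_pos _).le) (cycleWeight_nonneg _)

theorem mul_pmfVec_le {r : ℕ} (c : Fin r → ℕ) :
    (r + 1) * pmfVec r c ≤ cycleWeight (multOf c) := by
  have h := mul_le_mul_of_nonneg_right (prod_exp_le r) (cycleWeight_nonneg (multOf c))
  rw [← pmfVec_eq, one_div_mul_eq_div, le_div_iff₀ (by positivity)] at h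
  linarith

theorem mul_pmfVec_add_single {r : ℕ} (c : Fin r → ℕ) (j : Fin r) :
    ((j : ℕ) + 1 : ℝ) * ((c + Pi.single j 1 : Fin r → ℕ) j : ℝ) *
      pmfVec r (c + Pi.single j 1) = pmfVec r c := by
  rw [pmfVec_eq, pmfVec_eq, multOf_add_single, cycleWeight_cons, count_multOf]
  simp only [Pi.add_apply, Pi.single_eq_same]
  push_cast
  field_simp

/-- Markov's inequality for `∑ j X_j` under the law of `X_r` biased by `|𝓛(X_r)|`. -/
theorem markov_EL {r : ℕ} (C : Finset (Fin r → ℕ)) {B : ℝ}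
    (hC : ∀ c ∉ C, B ≤ ((multOf c).sum : ℝ))
    (hs : Summable fun c : Fin r → ℕ => ((Lset r c).card : ℝ) * pmfVec r c) :
    B * (EL r - ∑ c ∈ C, ((Lset r c).card : ℝ) * pmfVec r c) ≤ 2 * r * EL r := by
  set F : (Fin r → ℕ) → ℝ := fun c => ((Lset r c).card : ℝ) * pmfVec r c with hF
  have hF0 : ∀ c, 0 ≤ F c := fun c => mul_nonneg (Nat.cast_nonneg _) (pmfVec_nonneg c)
  have hEL : EL r = ∑' c, F c := rfl
  set g : Fin r → (Fin r → ℕ) → ℝ := fun j c => ((j : ℕ) + 1 : ℝ) * (c j : ℝ) * F c with hg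
  have hinj : ∀ j : Fin r, Function.Injective fun c : Fin r → ℕ => c + Pi.single j 1 :=
    fun j => add_left_injective _
  have hrange : ∀ (j : Fin r) (c : Fin r → ℕ),
      c ∉ Set.range (fun c : Fin r → ℕ => c + Pi.single j 1) → g j c = 0 := by
    intro j c hc
    have : c j = 0 := by
      by_contra h0
      refine hc ⟨c - Pi.single j 1, tsub_add_cancel_of_le fun i => ?_⟩
      by_cases hi : i = j
      · subst hi
        simp
        omega
      · simp [hi]
    simp [hg, this]
  have hshift : ∀ (j : Fin r) (c : Fin r → ℕ), g j (c + Pi.single j 1) ≤ 2 * F c := by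
    intro j c
    have h1 : g j (c + Pi.single j 1) =
        ((Lset r (c + Pi.single j 1)).card : ℝ) * pmfVec r c := by
      rw [← mul_pmfVec_add_single c j]
      simp only [hg, hF]
      ring
    rw [h1, hF, ← mul_assoc]
    refine mul_le_mul_of_nonneg_right ?_ (pmfVec_nonneg c)
    exact_mod_cast card_Lset_add_single_le c j
  have hg0 : ∀ j c, 0 ≤ g j c := fun j c => mul_nonneg (by positivity) (hF0 c)
  have hsum_shift : ∀ j, Summable fun c => g j (c + Pi.single j 1) := fun j =>
    Summable.of_nonneg_of_le (fun c => hg0 j _) (hshift j) (hs.mul_left 2)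
  have hsum : ∀ j, Summable (g j) := fun j =>
    ((hinj j).summable_iff (hrange j)).mp (hsum_shift j)
  have htsum : ∀ j, ∑' c, g j c ≤ 2 * EL r := by
    intro j
    rw [← (hinj j).tsum_eq (f := g j) fun c hc => by
      by_contra h
      exact hc (hrange j c h), hEL, ← tsum_mul_left]
    exact (hsum_shift j).tsum_le_tsum (hshift j) (hs.mul_left 2)
  have hind : Summable fun c => if c ∈ C then F c else 0 :=
    summable_of_ne_finset_zero (s := C) fun c hc => if_neg hc
  have hCsum : ∑ c ∈ C, F c = ∑' c, if c ∈ C then F c else 0 := by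
    rw [tsum_eq_sum (s := C) fun c hc => if_neg hc]
    exact Finset.sum_congr rfl fun c hc => (if_pos hc).symm
  calc B * (EL r - ∑ c ∈ C, F c)
      = ∑' c, B * (F c - if c ∈ C then F c else 0) := by
        rw [tsum_mul_left, hs.tsum_sub hind, ← hCsum, hEL]
    _ ≤ ∑' c, ∑ j, g j c := by
        refine ((hs.sub hind).mul_left B).tsum_le_tsum (fun c => ?_)
          (summable_sum fun j _ => hsum j)
        by_cases hc : c ∈ C
        · rw [if_pos hc, sub_self, mul_zero]
          exact Finset.sum_nonneg fun j _ => hg0 j c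
        · rw [if_neg hc, sub_zero]
          have : ∑ j, g j c = ((multOf c).sum : ℝ) * F c := by
            rw [sum_multOf]
            push_cast
            rw [Finset.sum_mul]
          rw [this]
          exact mul_le_mul_of_nonneg_right (hC c hc) (hF0 c)
    _ = ∑ j, ∑' c, g j c := Summable.tsum_finsetSum fun j _ => hsum j
    _ ≤ ∑ _j : Fin r, 2 * EL r := Finset.sum_le_sum fun j _ => htsum j
    _ = 2 * r * EL r := by
        rw [Finset.sum_const, Finset.card_univ, Fintype.card_fin, nsmul_eq_mul]
        ring

theorem card_filter_le_of_mem_partsGe {k m : ℕ} (hm : 0 < m) {q : Multiset ℕ}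
    (hq : q ∈ partsGe (min (k + 1) m) m) : (q.filter (· ≤ k)).card ≤ 1 := by
  obtain ⟨h1, h2⟩ := (mem_partsGe (lt_min k.succ_pos hm)).mp hq
  rcases lt_or_ge k m with hkm | hkm
  · rw [Multiset.filter_eq_nil.mpr fun a ha => ?_]
    · simp
    · have := h2 a ha
      omega
  · refine (Multiset.card_le_card (Multiset.filter_le _ _)).trans ?_
    have h3 := Multiset.card_nsmul_le_sum (s := q) (a := m) fun a ha => by
      have := h2 a ha
      omega
    rw [h1, smul_eq_mul] at h3
    exact le_of_mul_le_mul_right (by simpa using h3) hm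

/-- The multisets with sum `N` made of some `a ∈ A` together with parts all larger than `k`,
or, when `N - a ≤ k`, with the single part `N - a`. -/
def largeParts (k N : ℕ) (A : Finset ℕ) : Finset (Multiset ℕ) :=
  A.biUnion fun a => (partsGe (min (k + 1) (N - a)) (N - a)).image fun q => a ::ₘ q

theorem mem_largeParts {r k N : ℕ} {A : Finset ℕ}
    (hA : ∀ a ∈ A, r < a ∧ a ≤ k ∧ a + r < N) {p : Multiset ℕ} (hp : p ∈ largeParts k N A) :
    p.sum = N ∧ (∀ b ∈ p, r < b) ∧ ∃ a ∈ A, a ∈ p := by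
  obtain ⟨a, ha, hp⟩ := Finset.mem_biUnion.mp hp
  obtain ⟨q, hq, rfl⟩ := Finset.mem_image.mp hp
  obtain ⟨h1, h2, h3⟩ := hA a ha
  obtain ⟨hq1, hq2⟩ := (mem_partsGe (lt_min k.succ_pos (by omega))).mp hq
  refine ⟨?_, fun b hb => ?_, a, ha, Multiset.mem_cons_self a q⟩
  · rw [Multiset.sum_cons]
    omega
  · rcases Multiset.mem_cons.mp hb with rfl | hb
    · exact h1
    · have := hq2 b hb
      omega

theorem le_sum_largeParts {r k N : ℕ} {A : Finset ℕ}
    (hA : ∀ a ∈ A, r < a ∧ a ≤ k ∧ a + r < N) :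
    (A.card : ℝ) / (4 * k * (2 * k + 1)) ≤ ∑ p ∈ largeParts k N A, cycleWeight p := by
  set I : ℕ → Finset (Multiset ℕ) := fun a =>
    (partsGe (min (k + 1) (N - a)) (N - a)).image fun q => a ::ₘ q with hI
  have hfilter : ∀ a ∈ A, ∀ p ∈ I a, a ∈ p.filter (· ≤ k) ∧ (p.filter (· ≤ k)).card ≤ 2 := by
    intro a ha p hp
    obtain ⟨q, hq, rfl⟩ := Finset.mem_image.mp hp
    obtain ⟨h1, h2, h3⟩ := hA a ha
    have hc := card_filter_le_of_mem_partsGe (by omega) hq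
    rw [Multiset.filter_cons_of_pos (p := (· ≤ k)) _ h2, Multiset.card_cons]
    exact ⟨Multiset.mem_cons_self _ _, by omega⟩
  have hlow : ∀ a ∈ A, 1 / (2 * k * (2 * k + 1) : ℝ) ≤ ∑ p ∈ I a, cycleWeight p := by
    intro a ha
    obtain ⟨h1, h2, h3⟩ := hA a ha
    have ha0 : (0 : ℝ) < a := by exact_mod_cast (Nat.zero_le r).trans_lt h1
    have hak : (a : ℝ) ≤ k := by exact_mod_cast h2
    have hmin : 0 < min (k + 1) (N - a) := lt_min k.succ_pos (by omega)
    have hmin1 : (1 : ℝ) ≤ (min (k + 1) (N - a) : ℕ) := by exact_mod_cast hmin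
    have hmink : ((min (k + 1) (N - a) : ℕ) : ℝ) ≤ k + 1 := by
      exact_mod_cast min_le_left (k + 1) (N - a)
    have hP := le_sum_partsGe hmin (N - a) (min_le_right _ _)
    rw [hI, Finset.sum_image fun _ _ _ _ h => (Multiset.cons_inj_right a).mp h]
    calc 1 / (2 * k * (2 * k + 1) : ℝ)
        ≤ (1 / (2 * (min (k + 1) (N - a) : ℕ) - 1)) * (1 / (2 * a)) := by
          rw [one_div_mul_one_div]
          refine one_div_le_one_div_of_le (mul_pos (by linarith) (by linarith)) ?_
          rw [mul_comm (2 * k : ℝ)]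
          exact mul_le_mul (by linarith) (by linarith) (by linarith) (by linarith)
      _ ≤ (∑ q ∈ partsGe (min (k + 1) (N - a)) (N - a), cycleWeight q) * (1 / (2 * a)) :=
          mul_le_mul_of_nonneg_right hP (by positivity)
      _ ≤ _ := by
          rw [Finset.sum_mul]
          refine Finset.sum_le_sum fun q hq => ?_
          have hcount : q.count a ≤ 1 := by
            have h := card_filter_le_of_mem_partsGe (by omega) hq
            have h' := Multiset.count_le_card a (q.filter (· ≤ k))
            rw [Multiset.count_filter_of_pos (p := (· ≤ k)) h2] at h'
            omega
          have hcount' : (q.count a : ℝ) ≤ 1 := by exact_mod_cast hcount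
          rw [cycleWeight_cons, div_eq_mul_one_div (cycleWeight q)]
          refine mul_le_mul_of_nonneg_left ?_ (cycleWeight_nonneg q)
          refine one_div_le_one_div_of_le (by positivity) ?_
          rw [mul_comm (2 : ℝ)]
          exact mul_le_mul_of_nonneg_left (by linarith) ha0.le
  have hdouble : ∑ a ∈ A, ∑ p ∈ I a, cycleWeight p ≤
      2 * ∑ p ∈ largeParts k N A, cycleWeight p := by
    rw [Finset.sum_comm' (t' := largeParts k N A) (s' := fun p => A.filter fun a => p ∈ I a),
      Finset.mul_sum]
    · refine Finset.sum_le_sum fun p hp => ?_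
      rw [Finset.sum_const, nsmul_eq_mul]
      refine mul_le_mul_of_nonneg_right ?_ (cycleWeight_nonneg p)
      obtain ⟨a, ha, hpa⟩ := Finset.mem_biUnion.mp hp
      have hsub : (A.filter fun a => p ∈ I a) ⊆ (p.filter (· ≤ k)).toFinset := by
        intro b hb
        rw [Finset.mem_filter] at hb
        exact Multiset.mem_toFinset.mpr (hfilter b hb.1 p hb.2).1
      exact_mod_cast (Finset.card_le_card hsub).trans
        ((Multiset.toFinset_card_le _).trans (hfilter a ha p hpa).2)
    · intro a p
      simp only [largeParts, Finset.mem_filter, Finset.mem_biUnion]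
      exact ⟨fun h => ⟨h, a, h⟩, fun h => h.1⟩
  have hcard := Finset.card_nsmul_le_sum A _ _ hlow
  rw [nsmul_eq_mul] at hcard
  have heq : (A.card : ℝ) / (4 * k * (2 * k + 1)) =
      (A.card * (1 / (2 * k * (2 * k + 1) : ℝ))) / 2 := by
    rw [mul_one_div, div_div]
    congr 1
    ring
  rw [heq]
  linarith

/-- The vectors `c` with `∑ j * c_j < B`. -/
def smallVecs (r B : ℕ) : Finset (Fin r → ℕ) :=
  (Fintype.piFinset fun _ => Finset.range B).filter fun c => (multOf c).sum < B

theorem mem_smallVecs {r B : ℕ} {c : Fin r → ℕ} : c ∈ smallVecs r B ↔ (multOf c).sum < B := by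
  rw [smallVecs, Finset.mem_filter, and_iff_right_iff_imp]
  intro h
  refine Fintype.mem_piFinset.mpr fun j => Finset.mem_range.mpr (lt_of_le_of_lt ?_ h)
  rw [sum_multOf]
  refine le_trans ?_ (Finset.single_le_sum (f := fun j : Fin r => ((j : ℕ) + 1) * c j)
    (fun _ _ => Nat.zero_le _) (Finset.mem_univ j))
  exact Nat.le_mul_of_pos_left _ (Nat.succ_pos _)

theorem filter_multOf_add {r : ℕ} (c : Fin r → ℕ) {s : Multiset ℕ} (hs : ∀ b ∈ s, r < b) :
    (multOf c + s).filter (· ≤ r) = multOf c := by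
  rw [Multiset.filter_add, Multiset.filter_eq_self.mpr, Multiset.filter_eq_nil.mpr, add_zero]
  · exact fun b hb => not_le.mpr (hs b hb)
  · intro b hb
    obtain ⟨j, rfl⟩ := mem_multOf hb
    exact j.isLt

theorem sum_smallVecs_le_iProp {r k n : ℕ} (hrk : r < k) (hkn : 2 * k ≤ n) :
    (∑ c ∈ smallVecs r (k - r), ((Lset r c).card : ℝ) * cycleWeight (multOf c)) /
      (4 * k * (2 * k + 1)) ≤ iProp n k := by
  classical
  set A : (Fin r → ℕ) → Finset ℕ := fun c => (Lset r c).image fun l => k - l with hAdef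
  set S : (Fin r → ℕ) → Finset (Multiset ℕ) := fun c =>
    largeParts k (n - (multOf c).sum) (A c) with hSdef
  have hL : ∀ (c : Fin r → ℕ), ∀ l ∈ Lset r c, l ≤ (multOf c).sum := by
    intro c l hl
    obtain ⟨m, hm, rfl⟩ := mem_Lset.mp hl
    obtain ⟨u, hu⟩ := Multiset.le_iff_exists_add.mp (multOf_mono hm)
    rw [hu, Multiset.sum_add]
    exact Nat.le_add_right _ _
  have hA : ∀ c ∈ smallVecs r (k - r), ∀ a ∈ A c,
      r < a ∧ a ≤ k ∧ a + r < n - (multOf c).sum := by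
    intro c hc a ha
    have := mem_smallVecs.mp hc
    obtain ⟨l, hl, rfl⟩ := Finset.mem_image.mp ha
    have := hL c l hl
    omega
  have hAcard : ∀ c ∈ smallVecs r (k - r), (A c).card = (Lset r c).card := by
    intro c hc
    have hM := mem_smallVecs.mp hc
    refine Finset.card_image_of_injOn fun l hl l' hl' h => ?_
    have h1 := hL c l hl
    have h2 := hL c l' hl'
    omega
  have hS : ∀ c ∈ smallVecs r (k - r), ∀ s ∈ S c,
      s.sum = n - (multOf c).sum ∧ (∀ b ∈ s, r < b) ∧ ∃ a ∈ A c, a ∈ s :=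
    fun c hc s hs => mem_largeParts (hA c hc) hs
  set Φ : (Σ _ : Fin r → ℕ, Multiset ℕ) → Multiset ℕ := fun x => multOf x.1 + x.2 with hΦ
  have hinj : Set.InjOn Φ ((smallVecs r (k - r)).sigma S) := by
    rintro ⟨c, s⟩ hx ⟨d, t⟩ hy h
    obtain ⟨hc, hs⟩ := Finset.mem_sigma.mp hx
    obtain ⟨hd, ht⟩ := Finset.mem_sigma.mp hy
    have hfil : multOf c = multOf d := by
      rw [← filter_multOf_add c (hS c hc s hs).2.1, ← filter_multOf_add d (hS d hd t ht).2.1]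
      exact congrArg _ h
    have hcd : c = d := by
      funext j
      rw [← count_multOf c j, hfil, count_multOf]
    subst hcd
    have hst : s = t := add_left_cancel h
    rw [hst]
  have hT := sum_cycleWeight_le_iProp (n := n) (k := k)
    (((smallVecs r (k - r)).sigma S).image Φ) (by
      intro p hp
      obtain ⟨⟨c, s⟩, hx, rfl⟩ := Finset.mem_image.mp hp
      obtain ⟨hc, hs⟩ := Finset.mem_sigma.mp hx
      have hM : (multOf c).sum < k - r := mem_smallVecs.mp hc
      obtain ⟨h1, h2, a, ha, has⟩ := hS c hc s hs
      refine ⟨fun b hb => ?_, ?_, ?_⟩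
      · rcases Multiset.mem_add.mp hb with hb | hb
        · obtain ⟨j, rfl⟩ := mem_multOf hb
          exact Nat.succ_pos _
        · exact (Nat.zero_le r).trans_lt (h2 b hb)
      · simp only [hΦ, Multiset.sum_add] at h1 ⊢
        omega
      · obtain ⟨l, hl, rfl⟩ := Finset.mem_image.mp ha
        have hlM := hL c l hl
        obtain ⟨m, hm, rfl⟩ := mem_Lset.mp hl
        refine ⟨multOf m + {k - (multOf m).sum},
          add_le_add (multOf_mono hm) (Multiset.singleton_le.mpr has), ?_⟩
        rw [Multiset.sum_add, Multiset.sum_singleton]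
        omega)
  refine le_trans ?_ hT
  rw [Finset.sum_image hinj, Finset.sum_sigma, Finset.sum_div]
  refine Finset.sum_le_sum fun c hc => ?_
  have hlow := le_sum_largeParts (hA c hc)
  rw [hAcard c hc] at hlow
  calc _ = cycleWeight (multOf c) * ((Lset r c).card / (4 * k * (2 * k + 1))) := by ring
    _ ≤ cycleWeight (multOf c) * ∑ s ∈ S c, cycleWeight s :=
      mul_le_mul_of_nonneg_left hlow (cycleWeight_nonneg _)
    _ = _ := by
      rw [Finset.mul_sum]
      refine Finset.sum_congr rfl fun s hs => ?_
      refine (cycleWeight_add ?_).symm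
      rw [Multiset.disjoint_left]
      intro b hb hb'
      obtain ⟨j, rfl⟩ := mem_multOf hb
      have := (hS c hc s hs).2.1 _ hb'
      omega

theorem lower_bound_with_r (n k : ℕ) (hk : 40 ≤ k) (hkn : 2 * k ≤ n) :
    (1 : ℝ) / (2 ^ 13 * ((k / 20 : ℕ) : ℝ)) * EL (k / 20) ≤ iProp n k := by
  set r := k / 20 with hr
  have hr2 : 2 ≤ r := by omega
  have hkr : k ≤ 20 * r + 19 := by omega
  have hkr' : 20 * r ≤ k := by omega
  have hr2' : (2 : ℝ) ≤ r := by exact_mod_cast hr2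
  have hkR : (k : ℝ) ≤ 20 * r + 19 := by exact_mod_cast hkr
  have hk0 : (0 : ℝ) < k := by exact_mod_cast (by omega : 0 < k)
  by_cases hs : Summable fun c : Fin r → ℕ => ((Lset r c).card : ℝ) * pmfVec r c
  swap
  · rw [EL, tsum_eq_zero_of_not_summable hs, mul_zero, iProp]
    positivity
  have hEL0 : 0 ≤ EL r :=
    tsum_nonneg fun c => mul_nonneg (Nat.cast_nonneg _) (pmfVec_nonneg c)
  set Z := ∑ c ∈ smallVecs r (k - r), ((Lset r c).card : ℝ) * pmfVec r c with hZ
  have hmarkov : (19 * r : ℝ) * (EL r - Z) ≤ 2 * r * EL r := by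
    refine markov_EL _ (fun c hc => ?_) hs
    rw [mem_smallVecs] at hc
    exact_mod_cast (by omega : 19 * r ≤ (multOf c).sum)
  have hmarkov' : 17 / 19 * EL r ≤ Z := by
    have h : (r : ℝ) * (19 * (EL r - Z)) ≤ r * (2 * EL r) := by linarith
    have := le_of_mul_le_mul_left h (by linarith)
    linarith
  have hD : (0 : ℝ) < 4 * k * (2 * k + 1) := by positivity
  refine le_trans ?_ (sum_smallVecs_le_iProp (r := r) (by omega) hkn)
  have hZW : r * Z ≤
      ∑ c ∈ smallVecs r (k - r), ((Lset r c).card : ℝ) * cycleWeight (multOf c) := by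
    rw [hZ, Finset.mul_sum]
    refine Finset.sum_le_sum fun c _ => ?_
    have h1 := mul_pmfVec_le c
    have h2 := pmfVec_nonneg c
    calc _ = ((Lset r c).card : ℝ) * (r * pmfVec r c) := by ring
      _ ≤ _ := mul_le_mul_of_nonneg_left (by linarith) (Nat.cast_nonneg _)
  have hnum : 19 * (4 * k * (2 * k + 1)) ≤ 17 * 2 ^ 13 * (r : ℝ) * r := by
    have h1 : (k : ℝ) * (2 * k + 1) ≤ (20 * r + 19) * (2 * (20 * r + 19) + 1) :=
      mul_le_mul hkR (by linarith) (by positivity) (by positivity)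
    nlinarith
  calc 1 / (2 ^ 13 * (r : ℝ)) * EL r
      ≤ (r * (17 / 19 * EL r)) / (4 * k * (2 * k + 1)) := by
        rw [le_div_iff₀ hD, one_div_mul_eq_div, div_mul_eq_mul_div, div_le_iff₀ (by positivity)]
        have := mul_le_mul_of_nonneg_left hnum hEL0
        linarith
    _ ≤ (r * Z) / (4 * k * (2 * k + 1)) := by gcongr
    _ ≤ _ := by gcongr
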